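/- Under the stated hypotheses on Φ and f, the following relation holds among partial derivatives at 0: Y3_{x3}(0) + Y3_{y3}(0) = 1. -/

import Mathlib

noncomputable section

/-- The model space `ℝ^13` with coordinates
`(t, x0, y0, x1, y1, x2, y2, x3, y3, x4, y4, x5, y5)`
indexed by `0, 1, ..., 12` respectively. -/
abbrev E13 := Fin 13 → ℝ

/-- The constant coordinate vector field `∂_u` of the `i`-th coordinate. -/
def e (i : Fin 13) : E13 := Pi.single i 1

/-- Partial derivative of a scalar function `F` in the `i`-th coordinate
direction, at a point `p`. -/
def pd (F : E13 → ℝ) (i : Fin 13) (p : E13) : ℝ := fderiv ℝ F p (e i)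

/-- The vector field `Z''_{1,a}` of the EKR pseudo-normal form for the
singularity class 1.2.1.2.1 (at tangency points with the locus of 1.2.1.2):
`Z''_{1,a} = ∂_{x3} + (1 + y4)·∂_{y3} + x5·∂_{x4} + (a + y5)·∂_{y4}
 + x4·( ∂_{x1} + y2·∂_{y1} + (1 + x3)·∂_{x2} + y3·∂_{y2} + x2·( ∂_t + x1·∂_{x0} + y1·∂_{y0} ) )`. -/
def Z (a : ℝ) (p : E13) : E13 :=
  e 7 + (1 + p 10) • e 8 + p 11 • e 9 + (a + p 12) • e 10 +
    p 9 • (e 3 + p 6 • e 4 + (1 + p 7) • e 5 + p 8 • e 6 +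
      p 5 • (e 0 + p 3 • e 1 + p 4 • e 2))

open Filter Topology in
/-- A common factor `p i` can be cancelled from an identity between continuous functions. -/
lemma eqOn_of_coord_mul_eq {U : Set E13} (hU : IsOpen U) (i : Fin 13) {a b : E13 → ℝ}
    (ha : ContinuousOn a U) (hb : ContinuousOn b U)
    (h : ∀ p ∈ U, p i * a p = p i * b p) : Set.EqOn a b U := by
  intro p hp
  by_cases hpi : p i = 0
  · have hline : Tendsto (fun u : ℝ => p + u • e i) (𝓝[≠] 0) (𝓝 p) := by
      have hc : Continuous (fun u : ℝ => p + u • e i) := by fun_prop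
      simpa using (hc.tendsto 0).mono_left nhdsWithin_le_nhds
    have hUp : U ∈ 𝓝 p := hU.mem_nhds hp
    refine tendsto_nhds_unique_of_eventuallyEq
      ((ha.continuousAt hUp).tendsto.comp hline) ((hb.continuousAt hUp).tendsto.comp hline) ?_
    filter_upwards [hline hUp, self_mem_nhdsWithin] with u hu hu0
    have hne : (p + u • e i) i ≠ 0 := by simpa [hpi, e] using hu0
    exact mul_left_cancel₀ hne (h _ hu)
  · exact mul_left_cancel₀ hpi (h p hp)

/-- If `F` is invariant under translation by multiples of `v`, its derivative kills `v`. -/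
lemma fderiv_apply_eq_zero_of_translation_invariant {F : E13 → ℝ} {v : E13}
    (hF : ∀ p : E13, ∀ s : ℝ, F (p + s • v) = F p) (p : E13) : fderiv ℝ F p v = 0 := by
  by_cases hd : DifferentiableAt ℝ F p
  · rw [← hd.lineDeriv_eq_fderiv]
    simp [lineDeriv, hF]
  · simp [fderiv_zero_of_not_differentiableAt hd]

/-- If `F` is invariant under translation by `v`, so is its derivative. -/
lemma fderiv_add_eq_of_translation_invariant {F : E13 → ℝ} {v : E13}
    (hF : ∀ p : E13, F (p + v) = F p) (p : E13) : fderiv ℝ F (p + v) = fderiv ℝ F p := by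
  rw [← fderiv_comp_add_right]
  simp only [hF]

/-- Elements of the span of `∂_{x5}, ∂_{y5}` have vanishing other components. -/
lemma apply_eq_zero_of_mem_span {v : E13}
    (hv : v ∈ Submodule.span ℝ ({e 11, e 12} : Set E13)) {i : Fin 13}
    (h11 : i ≠ 11) (h12 : i ≠ 12) : v i = 0 := by
  obtain ⟨a, b, rfl⟩ := Submodule.mem_span_pair.1 hv
  simp [e, h11, h12]

/-- The factor of `x4` in the vector field `Z`. -/
def Zinner (p : E13) : E13 :=
  e 3 + p 6 • e 4 + (1 + p 7) • e 5 + p 8 • e 6 + p 5 • (e 0 + p 3 • e 1 + p 4 • e 2)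

lemma continuous_Zinner : Continuous Zinner := by
  unfold Zinner
  fun_prop

/-- `Y3_{x3}(0) + Y3_{y3}(0) = 1`. -/
theorem relation_52_12121 (c c' : ℝ)
    (Φ : E13 → E13) (U : Set E13) (hU : IsOpen U) (h0U : (0 : E13) ∈ U)
    (hΦsmooth : ContDiffOn ℝ (⊤ : ℕ∞) Φ U) (hΦ0 : Φ 0 = 0)
    (hdiffeo : Function.Bijective (fderiv ℝ Φ 0))
    -- the components `T, X0, Y0` (indices 0,1,2) depend only on `t, x0, y0`
    (htri0 : ∀ p q : E13, (∀ k : Fin 13, (k : ℕ) ≤ 2 → p k = q k) →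
      ∀ i : Fin 13, (i : ℕ) ≤ 2 → Φ p i = Φ q i)
    -- for `1 ≤ j ≤ 5`, the components `Xj, Yj` (indices 2j+1, 2j+2)
    -- depend only on `t, x0, y0, x1, y1, ..., xj, yj`
    (htri : ∀ j : ℕ, 1 ≤ j → j ≤ 5 → ∀ p q : E13,
      (∀ k : Fin 13, (k : ℕ) ≤ 2 * j + 2 → p k = q k) →
      ∀ i : Fin 13, ((i : ℕ) = 2 * j + 1 ∨ (i : ℕ) = 2 * j + 2) → Φ p i = Φ q i)
    (H G : E13 → ℝ)
    (hHs : ContDiffOn ℝ (⊤ : ℕ∞) H U) (hGs : ContDiffOn ℝ (⊤ : ℕ∞) G U)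
    (hH0 : H 0 ≠ 0) (hG0 : G 0 ≠ 0)
    -- `X2 = x2·H`, `X4 = x4·G`
    (hX2 : ∀ p ∈ U, Φ p 5 = p 5 * H p)
    (hX4 : ∀ p ∈ U, Φ p 9 = p 9 * G p)
    (f : E13 → ℝ) (hfs : ContDiffOn ℝ (⊤ : ℕ∞) f U) (hf0 : f 0 ≠ 0)
    -- `dΦ(p)·Z_{1,c}(p) − f(p)·Z_{1,c'}(Φ(p)) ∈ span{∂_{x5}, ∂_{y5}}` near 0
    (hconj : ∀ p ∈ U, fderiv ℝ Φ p (Z c p) - f p • Z c' (Φ p) ∈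
      Submodule.span ℝ ({e 11, e 12} : Set E13)) :
    pd (fun p => Φ p 8) 7 0 + pd (fun p => Φ p 8) 8 0 = 1 := by
  have hΦd : ∀ p ∈ U, DifferentiableAt ℝ Φ p := fun p hp =>
    (hΦsmooth.contDiffAt (hU.mem_nhds hp)).differentiableAt (by simp)
  have hcomp : ∀ i : Fin 13, ∀ p ∈ U, ∀ v : E13,
      fderiv ℝ Φ p v i = fderiv ℝ (fun q => Φ q i) p v := fun i p hp v => by
    rw [fderiv_apply (hΦd p hp)]
    rfl
  have hcont : ContinuousOn (fderiv ℝ Φ) U :=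
    hΦsmooth.continuousOn_fderiv_of_isOpen hU (by simp)
  have hrel : ∀ i : Fin 13, i ≠ 11 → i ≠ 12 → ∀ p ∈ U,
      fderiv ℝ (fun q => Φ q i) p (Z c p) = f p * Z c' (Φ p) i := by
    intro i h11 h12 p hp
    have h := apply_eq_zero_of_mem_span (hconj p hp) h11 h12
    rw [Pi.sub_apply, hcomp i p hp] at h
    simpa using sub_eq_zero.1 h
  -- invariance of the components under translation along later coordinates
  have hinv : ∀ j : ℕ, 1 ≤ j → j ≤ 5 → ∀ i : Fin 13,
      ((i : ℕ) = 2 * j + 1 ∨ (i : ℕ) = 2 * j + 2) → ∀ v : E13,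
      (∀ k : Fin 13, (k : ℕ) ≤ 2 * j + 2 → v k = 0) → ∀ p : E13, Φ (p + v) i = Φ p i :=
    fun j h1 h5 i hi v hv p => htri j h1 h5 _ _ (fun k hk => by simp [hv k hk]) i hi
  have hkill : ∀ j : ℕ, 1 ≤ j → j ≤ 5 → ∀ i : Fin 13,
      ((i : ℕ) = 2 * j + 1 ∨ (i : ℕ) = 2 * j + 2) → ∀ m : Fin 13, 2 * j + 2 < (m : ℕ) →
      ∀ p : E13, fderiv ℝ (fun q => Φ q i) p (e m) = 0 := by
    intro j h1 h5 i hi m hm p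
    refine fderiv_apply_eq_zero_of_translation_invariant (fun q s => ?_) p
    refine hinv j h1 h5 i hi _ (fun k hk => ?_) q
    have hkm : k ≠ m := by
      rintro rfl
      omega
    simp [e, hkm]
  have hZ : ∀ p : E13, Z c p = e 7 + (1 + p 10) • e 8 + p 11 • e 9 + (c + p 12) • e 10 +
      p 9 • Zinner p := fun p => rfl
  have hcontZ : ∀ i : Fin 13, ContinuousOn (fun p => fderiv ℝ Φ p (Zinner p) i) U := fun i =>
    (continuous_apply i).comp_continuousOn (hcont.clm_apply continuous_Zinner.continuousOn)
  -- the `X1` and `X2` components of the conjugacy relation, divided by `x4`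
  have hX1 : Set.EqOn (fun p => fderiv ℝ Φ p (Zinner p) 3) (fun p => f p * G p) U := by
    refine eqOn_of_coord_mul_eq hU 9 (hcontZ 3) (hfs.continuousOn.mul hGs.continuousOn) ?_
    intro p hp
    have h := hrel 3 (by decide) (by decide) p hp
    rw [hZ] at h
    have k := hkill 1 (by norm_num) (by norm_num) 3 (by simp)
    simp only [map_add, map_smul, smul_eq_mul, k 7 (by simp), k 8 (by simp), k 9 (by simp),
      k 10 (by simp)] at h
    rw [hcomp 3 p hp]
    simp [Z, e, hX4 p hp] at h
    linarith
  have hX2' : Set.EqOn (fun p => fderiv ℝ Φ p (Zinner p) 5)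
      (fun p => f p * G p * (1 + Φ p 7)) U := by
    refine eqOn_of_coord_mul_eq hU 9 (hcontZ 5) ((hfs.continuousOn.mul hGs.continuousOn).mul
      (continuousOn_const.add ((continuous_apply 7).comp_continuousOn
        hΦsmooth.continuousOn))) ?_
    intro p hp
    have h := hrel 5 (by decide) (by decide) p hp
    rw [hZ] at h
    have k := hkill 2 (by norm_num) (by norm_num) 5 (by simp)
    simp only [map_add, map_smul, smul_eq_mul, k 7 (by simp), k 8 (by simp), k 9 (by simp),
      k 10 (by simp)] at h
    rw [hcomp 5 p hp]
    simp [Z, e, hX4 p hp] at h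
    linarith
  have hdX2 : ∀ p ∈ U, p 5 = 0 → ∀ v, fderiv ℝ (fun q => Φ q 5) p v = H p * v 5 := by
    intro p hp hp5 v
    have heq : (fun q => Φ q 5) =ᶠ[nhds p] fun q => q 5 * H q :=
      Filter.eventually_of_mem (hU.mem_nhds hp) hX2
    have hHd : DifferentiableAt ℝ H p :=
      (hHs.contDiffAt (hU.mem_nhds hp)).differentiableAt (by simp)
    have hproj : HasFDerivAt (fun q : E13 => q 5)
        (ContinuousLinearMap.proj (R := ℝ) (φ := fun _ : Fin 13 => ℝ) 5) p :=
      hasFDerivAt_apply 5 p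
    rw [heq.fderiv_eq, (hproj.fun_mul hHd.hasFDerivAt).fderiv]
    simp [hp5]
  -- along the line spanned by `w = ∂_{x3} + ∂_{y3}` the component `X3` is the parameter
  set w : E13 := e 7 + e 8 with hw
  have hwk : ∀ s : ℝ, ∀ k : Fin 13, (k : ℕ) ≤ 6 → (s • w) k = 0 := by
    intro s k hk
    have h7 : k ≠ 7 := by rintro rfl; simp at hk
    have h8 : k ≠ 8 := by rintro rfl; simp at hk
    simp [hw, e, h7, h8]
  have hw7 : ∀ s : ℝ, (s • w) 7 = s := fun s => by simp [hw, e]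
  have hfG : ∀ s : ℝ, s • w ∈ U → f (s • w) * G (s • w) = f 0 * G 0 := by
    intro s hs
    have k := hkill 1 (by norm_num) (by norm_num) 3 (by simp)
    have hconst := fderiv_add_eq_of_translation_invariant (F := fun q => Φ q 3)
      (hinv 1 (by norm_num) (by norm_num) 3 (by simp) (s • w)
        (fun k hk => hwk s k (by omega))) 0
    rw [zero_add] at hconst
    have a := hX1 hs
    have b := hX1 h0U
    simp only [hcomp 3 _ hs, hcomp 3 _ h0U, hconst, Zinner, map_add, map_smul, k 5 (by simp),
      k 6 (by simp), hwk s 5 (by simp), hwk s 6 (by simp), Pi.zero_apply, zero_smul, smul_zero,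
      add_zero] at a b
    rw [← a, ← b]
  have hHconst : ∀ s : ℝ, s • w ∈ U → H (s • w) = H 0 := by
    intro s hs
    have hconst := fderiv_add_eq_of_translation_invariant (F := fun q => Φ q 5)
      (hinv 2 (by norm_num) (by norm_num) 5 (by simp) (s • w)
        (fun k hk => hwk s k (by omega))) 0
    rw [zero_add] at hconst
    have a := hdX2 _ hs (hwk s 5 (by simp)) (e 5)
    have b := hdX2 _ h0U rfl (e 5)
    rw [hconst, b] at a
    simpa [e] using a.symm
  have hline : ∀ s : ℝ, s • w ∈ U → (1 + s) * H 0 = f 0 * G 0 * (1 + Φ (s • w) 7) := by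
    intro s hs
    have a := hX2' hs
    simp only [hcomp 5 _ hs, hdX2 _ hs (hwk s 5 (by simp)), hfG s hs, hHconst s hs] at a
    have z5 : Zinner (s • w) 5 = 1 + s := by
      simp [Zinner, e, hw]
    rw [z5] at a
    linarith
  have hH0eq : H 0 = f 0 * G 0 := by
    have h := hline 0 (by simpa using h0U)
    simpa [hΦ0] using h
  have hX3 : ∀ s : ℝ, s • w ∈ U → Φ (s • w) 7 = s := by
    intro s hs
    have h := hline s hs
    rw [← hH0eq, mul_comm] at h
    have := mul_left_cancel₀ hH0 h
    linarith
  have hdX3 : fderiv ℝ (fun q => Φ q 7) 0 w = 1 := by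
    have hd : DifferentiableAt ℝ (fun q => Φ q 7) 0 := differentiableAt_pi.1 (hΦd 0 h0U) 7
    have hmem : ∀ᶠ s : ℝ in nhds 0, s • w ∈ U := by
      have hc : Continuous (fun s : ℝ => s • w) := by fun_prop
      exact hc.continuousAt.preimage_mem_nhds (hU.mem_nhds (by simpa using h0U))
    have heq : (fun s : ℝ => Φ (0 + s • w) 7) =ᶠ[nhds 0] fun s => s :=
      hmem.mono fun s hs => by simpa using hX3 s hs
    rw [← hd.lineDeriv_eq_fderiv, lineDeriv, heq.deriv_eq]
    simp
  have hZ0 : Z c 0 = w + c • e 10 := by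
    simp [Z, hw]
  have hf1 : f 0 = 1 := by
    have h := hrel 7 (by decide) (by decide) 0 h0U
    rw [hZ0, map_add, map_smul, hdX3,
      hkill 3 (by norm_num) (by norm_num) 7 (by simp) 10 (by simp), hΦ0] at h
    simpa [Z, e] using h.symm
  have h := hrel 8 (by decide) (by decide) 0 h0U
  rw [hZ0, map_add, map_smul,
    hkill 3 (by norm_num) (by norm_num) 8 (by simp) 10 (by simp), hΦ0, hf1, hw, map_add] at h
  simpa [Z, e, pd] using h
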